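/- arXiv:2602.23892 — 2 statements merged into one kernel-verified Lean document; each statement's English description precedes it below -/
import Mathlib

section
/- Existence and uniqueness of the optimal Tsallis-regularized decision density (finite case): let U be a finite nonempty type, let q be a pmf on U with q(u) > 0 for all u, let J : U → ℝ be any cost function, let ρ > 0, and let r > 0 with r ≠ 1. Then the functional F(p) = (1/ρ)·∑_u p(u)·J(u) + D_r(p‖q) attains its minimum over the set of pmfs on U, and the minimizer is unique. -/
open Finset

/-- The deformed (Tsallis) logarithm `log_r v = (v^(r-1) - 1)/(r-1)`. -/
noncomputable def qlog (r v : ℝ) : ℝ := (v ^ (r - 1) - 1) / (r - 1)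

/-- A probability mass function on a finite type. -/
def IsPmf {U : Type*} [Fintype U] (p : U → ℝ) : Prop :=
  (∀ u, 0 ≤ p u) ∧ ∑ u, p u = 1

/-- The Tsallis divergence `D_r(p‖q) = ∑_u p u · log_r (p u / q u)`,
with the convention that terms with `p u = 0` contribute `0`. -/
noncomputable def tsallisDiv (r : ℝ) {U : Type*} [Fintype U] (p q : U → ℝ) : ℝ :=
  ∑ u, if p u = 0 then 0 else p u * qlog r (p u / q u)

/-- A sum of strictly convex functions of the individual coordinates is strictly convex. -/
theorem strictConvexOn_sum_apply {U : Type*} [Fintype U] {s : Set ℝ} {S : Set (U → ℝ)}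
    (hS : Convex ℝ S) (hSs : ∀ p ∈ S, ∀ u, p u ∈ s) {f : U → ℝ → ℝ}
    (hf : ∀ u, StrictConvexOn ℝ s (f u)) : StrictConvexOn ℝ S fun p ↦ ∑ u, f u (p u) := by
  refine ⟨hS, fun p hp p' hp' hne a b ha hb hab ↦ ?_⟩
  obtain ⟨v, hv⟩ := Function.ne_iff.mp hne
  simp only [smul_eq_mul, Finset.mul_sum, ← Finset.sum_add_distrib]
  exact Finset.sum_lt_sum
    (fun u _ ↦ (hf u).convexOn.2 (hSs p hp u) (hSs p' hp' u) ha.le hb.le hab)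
    ⟨v, Finset.mem_univ v, (hf v).2 (hSs p hp v) (hSs p' hp' v) hv ha hb hab⟩

theorem strictConvexOn_rpow_div_sub_one {r : ℝ} (hr0 : 0 < r) (hr1 : r ≠ 1) :
    StrictConvexOn ℝ (Set.Ici 0) fun x : ℝ ↦ x ^ r / (r - 1) := by
  refine ⟨convex_Ici 0, fun x hx y hy hxy a b ha hb hab ↦ ?_⟩
  rcases hr1.lt_or_gt with h | h
  · have key := (Real.strictConcaveOn_rpow hr0 h).2 hx hy hxy ha hb hab
    have := div_lt_div_of_neg_of_lt (sub_neg.mpr h) key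
    simp only [smul_eq_mul] at this ⊢
    rwa [add_div, mul_div_assoc, mul_div_assoc] at this
  · have key := (strictConvexOn_rpow h).2 hx hy hxy ha hb hab
    have := div_lt_div_of_pos_right key (sub_pos.mpr h)
    simp only [smul_eq_mul] at this ⊢
    rwa [add_div, mul_div_assoc, mul_div_assoc] at this

theorem ite_mul_qlog_div {r c x : ℝ} (hr0 : 0 < r) (hc : 0 < c) (hx : 0 ≤ x) :
    (if x = 0 then 0 else x * qlog r (x / c)) =
      c ^ (1 - r) * (x ^ r / (r - 1)) - x / (r - 1) := by
  rcases hx.eq_or_lt with rfl | hx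
  · simp [Real.zero_rpow hr0.ne']
  · rw [if_neg hx.ne', qlog, Real.div_rpow hx.le hc.le, Real.rpow_sub hx, Real.rpow_sub hc,
      Real.rpow_sub hc, Real.rpow_one, Real.rpow_one]
    have := (Real.rpow_pos_of_pos hc r).ne'
    field_simp

/-- On the simplex, the Tsallis-regularized functional is a sum of continuous functions of the
individual probabilities. -/
theorem regularized_eq_sum {U : Type*} [Fintype U] {p q J : U → ℝ} {ρ r : ℝ}
    (hq : ∀ u, 0 < q u) (hr0 : 0 < r) (hp : IsPmf p) :
    (1 / ρ) * ∑ u, p u * J u + tsallisDiv r p q =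
      ∑ u, (q u ^ (1 - r) * (p u ^ r / (r - 1)) + (J u / ρ - 1 / (r - 1)) * p u) := by
  rw [tsallisDiv, Finset.mul_sum, ← Finset.sum_add_distrib]
  refine Finset.sum_congr rfl fun u _ ↦ ?_
  rw [ite_mul_qlog_div hr0 (hq u) (hp.1 u)]
  ring

/-- the Tsallis-regularized functional
`F p = (1/ρ) ∑_u p u · J u + D_r(p‖q)` attains its minimum over the pmfs on `U`,
and the minimizer is unique. -/
theorem tsallis_regularized_min_exists_unique {U : Type*} [Fintype U] [Nonempty U]
    (q : U → ℝ) (hq : IsPmf q) (hq' : ∀ u, 0 < q u)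
    (J : U → ℝ) (ρ : ℝ) (hρ : 0 < ρ) (r : ℝ) (hr0 : 0 < r) (hr1 : r ≠ 1) :
    ∃ p : U → ℝ, IsPmf p ∧
      (∀ p' : U → ℝ, IsPmf p' →
        (1 / ρ) * ∑ u, p u * J u + tsallisDiv r p q ≤
          (1 / ρ) * ∑ u, p' u * J u + tsallisDiv r p' q) ∧
      (∀ p' : U → ℝ, IsPmf p' →
        (∀ p'' : U → ℝ, IsPmf p'' →
          (1 / ρ) * ∑ u, p' u * J u + tsallisDiv r p' q ≤
            (1 / ρ) * ∑ u, p'' u * J u + tsallisDiv r p'' q) →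
        p' = p) := by
  let G : (U → ℝ) → ℝ := fun p ↦
    ∑ u, (q u ^ (1 - r) * (p u ^ r / (r - 1)) + (J u / ρ - 1 / (r - 1)) * p u)
  have hFG : ∀ p, IsPmf p → (1 / ρ) * ∑ u, p u * J u + tsallisDiv r p q = G p :=
    fun p hp ↦ regularized_eq_sum hq' hr0 hp
  have hcont : Continuous G := by
    refine continuous_finsetSum _ fun u _ ↦ ?_
    have := (continuous_apply (A := fun _ : U ↦ ℝ) u).rpow_const (p := r) fun _ ↦ Or.inr hr0.le
    fun_prop
  have hconv : StrictConvexOn ℝ (stdSimplex ℝ U) G := by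
    refine strictConvexOn_sum_apply
      (f := fun u x ↦ q u ^ (1 - r) * (x ^ r / (r - 1)) + (J u / ρ - 1 / (r - 1)) * x)
      (convex_stdSimplex ℝ U) (fun p hp ↦ hp.1) fun u ↦ ⟨convex_Ici 0, ?_⟩
    intro x hx y hy hxy a b ha hb hab
    have := mul_lt_mul_of_pos_left
      ((strictConvexOn_rpow_div_sub_one hr0 hr1).2 hx hy hxy ha hb hab)
      (Real.rpow_pos_of_pos (hq' u) (1 - r))
    simp only [smul_eq_mul] at this ⊢
    linarith
  obtain ⟨p, hp, hmin⟩ :=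
    (isCompact_stdSimplex ℝ U).exists_isMinOn ⟨q, hq⟩ hcont.continuousOn
  refine ⟨p, hp, fun p' hp' ↦ ?_, fun p' hp' hmin' ↦ ?_⟩
  · rw [hFG p hp, hFG p' hp']
    exact hmin hp'
  · refine hconv.eq_of_isMinOn (fun p'' hp'' ↦ ?_) hmin hp' hp
    have := hmin' p'' hp''
    rwa [hFG p' hp', hFG p'' hp''] at this
end

section
/- Closed form of the optimal Tsallis-regularized decision density (finite case): let U be a finite nonempty type, let q be a pmf on U with q(u) > 0 for all u, let J : U → ℝ, let ρ > 0, let r > 0 with r ≠ 1, and let p* be a pmf on U with p*(u) > 0 for all u. Then p* minimizes F(p) = (1/ρ)·∑_u p(u)·J(u) + D_r(p‖q) over all pmfs p on U if and only if there exists λ ∈ ℝ such that for every u, 1 + (r−1)·(λ − J(u)/ρ) > 0 and p*(u) = q(u)·((1 + (r−1)·(λ − J(u)/ρ))/r)^(1/(r−1)); equivalently, p*(u) = r^(−1/(r−1))·q(u)·exp_r(λ − J(u)/ρ), so the optimal density is a deformed-exponential twist of the reference density q. -/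
open Finset

/-- The deformed (Tsallis) exponential `exp_r v = (max 0 (1 + (r-1) v))^(1/(r-1))`. -/
noncomputable def qexp (r v : ℝ) : ℝ := (max 0 (1 + (r - 1) * v)) ^ (1 / (r - 1))

/-- For a nonnegative `p`, the Tsallis divergence is the `f`-divergence of
`f x = (x ^ r - x) / (r - 1)`, without a case distinction at `p u = 0`. -/
theorem tsallisDiv_eq_sum {U : Type*} [Fintype U] {r : ℝ} (hr : 0 < r) {p q : U → ℝ}
    (hp : ∀ u, 0 ≤ p u) (hq : ∀ u, 0 < q u) :
    tsallisDiv r p q = ∑ u, q u * (((p u / q u) ^ r - p u / q u) / (r - 1)) := by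
  refine Finset.sum_congr rfl fun u _ => ?_
  split_ifs with h
  · simp [h, Real.zero_rpow hr.ne']
  · have hx : 0 < p u / q u := div_pos ((hp u).lt_of_ne' h) (hq u)
    have hpq : p u = q u * (p u / q u) := (mul_div_cancel₀ (p u) (hq u).ne').symm
    have hpow : (p u / q u) ^ r = p u / q u * (p u / q u) ^ (r - 1) := by
      rw [Real.rpow_sub_one hx.ne', mul_div_cancel₀ _ hx.ne']
    rw [qlog, hpow]
    nth_rewrite 1 [hpq]
    ring

/-- Bernoulli's inequality for all positive exponents other than `1`, in the form of the tangent
line at `x` of the convex function `x ↦ (x ^ r - x) / (r - 1)`. -/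
theorem tangent_le_rpow_sub_self_div {r x y : ℝ} (hr0 : 0 < r) (hr1 : r ≠ 1)
    (hx : 0 < x) (hy : 0 ≤ y) :
    (x ^ r - x) / (r - 1) + (r * x ^ (r - 1) - 1) / (r - 1) * (y - x) ≤
      (y ^ r - y) / (r - 1) := by
  have hbern : 0 ≤ ((y / x) ^ r - (1 + r * (y / x - 1))) / (r - 1) := by
    have ht : -1 ≤ y / x - 1 := by linarith [div_nonneg hy hx.le]
    rcases lt_or_gt_of_ne hr1 with h | h
    · refine div_nonneg_of_nonpos ?_ (by linarith)
      have := rpow_one_add_le_one_add_mul_self ht hr0.le h.le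
      rw [add_sub_cancel] at this
      linarith
    · refine div_nonneg ?_ (by linarith)
      have := one_add_mul_self_le_rpow_one_add ht h.le
      rw [add_sub_cancel] at this
      linarith
  have hxr : 0 < x ^ r := Real.rpow_pos_of_pos hx r
  have key : (y ^ r - y) / (r - 1) -
      ((x ^ r - x) / (r - 1) + (r * x ^ (r - 1) - 1) / (r - 1) * (y - x)) =
      x ^ r * (((y / x) ^ r - (1 + r * (y / x - 1))) / (r - 1)) := by
    have := sub_ne_zero.mpr hr1
    rw [Real.div_rpow hy hx.le, Real.rpow_sub_one hx.ne']
    field_simp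
    ring
  linarith [mul_nonneg hxr.le hbern]

/-- The derivative of `x ↦ (x ^ r - x) / (r - 1)`, along the line `t ↦ (a + t * d) / b` and
scaled by `b`. -/
theorem hasDerivAt_mul_rpow_sub_self_div {r a b : ℝ} (d : ℝ) (ha : 0 < a) (hb : 0 < b) :
    HasDerivAt (fun t : ℝ => b * ((((a + t * d) / b) ^ r - (a + t * d) / b) / (r - 1)))
      (d * ((r * (a / b) ^ (r - 1) - 1) / (r - 1))) 0 := by
  have hline : HasDerivAt (fun t : ℝ => (a + t * d) / b) (d / b) 0 := by
    simpa using (((hasDerivAt_id (0 : ℝ)).mul_const d).const_add a).div_const b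
  have hpow := hline.rpow_const (p := r) (Or.inl (by simp [ha.ne', hb.ne']))
  refine (((hpow.sub hline).div_const (r - 1)).const_mul b).congr_deriv ?_
  rw [zero_mul, add_zero]
  field_simp

/-- Solving the stationarity condition `c + (r * x ^ (r - 1) - 1) / (r - 1) = lam` for `x`. -/
theorem stationarity_iff_closed_form {r a b c lam : ℝ} (hr0 : 0 < r) (hr1 : r ≠ 1)
    (ha : 0 < a) (hb : 0 < b) :
    c + (r * (a / b) ^ (r - 1) - 1) / (r - 1) = lam ↔
      0 < 1 + (r - 1) * (lam - c) ∧
        a = b * ((1 + (r - 1) * (lam - c)) / r) ^ (1 / (r - 1)) ∧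
        a = r ^ (-(1 / (r - 1))) * b * qexp r (lam - c) := by
  have hr : r - 1 ≠ 0 := sub_ne_zero.mpr hr1
  have hx : 0 < a / b := div_pos ha hb
  constructor
  · rintro rfl
    have hw : 1 + (r - 1) * (c + (r * (a / b) ^ (r - 1) - 1) / (r - 1) - c) =
        r * (a / b) ^ (r - 1) := by
      field_simp
      ring
    have hroot : ((a / b) ^ (r - 1)) ^ (1 / (r - 1)) = a / b := by
      rw [one_div, Real.rpow_rpow_inv hx.le hr]
    have hpos : 0 < (a / b) ^ (r - 1) := Real.rpow_pos_of_pos hx _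
    rw [qexp, hw]
    refine ⟨by positivity, ?_, ?_⟩
    · rw [mul_div_cancel_left₀ _ hr0.ne', hroot, mul_div_cancel₀ _ hb.ne']
    · rw [max_eq_right (by positivity), Real.mul_rpow hr0.le hpos.le, hroot,
        Real.rpow_neg hr0.le]
      have := (Real.rpow_pos_of_pos hr0 (1 / (r - 1))).ne'
      field_simp
  · rintro ⟨hpos, hab, -⟩
    have hpow : (a / b) ^ (r - 1) = (1 + (r - 1) * (lam - c)) / r := by
      rw [hab, mul_div_cancel_left₀ _ hb.ne', one_div,
        Real.rpow_inv_rpow (div_pos hpos hr0).le hr]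
    rw [hpow]
    field_simp
    ring

/-- At a strictly positive minimizer over pmfs, the directional derivative of the regularized
objective vanishes along every direction of total mass zero. -/
theorem sum_mul_gradient_eq_zero_of_isMin {U : Type*} [Fintype U] {q J pstar : U → ℝ} {ρ r : ℝ}
    (hq : ∀ u, 0 < q u) (hr : 0 < r) (hsum : ∑ u, pstar u = 1) (hpos : ∀ u, 0 < pstar u)
    (hmin : ∀ p : U → ℝ, IsPmf p →
      (1 / ρ) * ∑ u, pstar u * J u + tsallisDiv r pstar q ≤
        (1 / ρ) * ∑ u, p u * J u + tsallisDiv r p q)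
    {d : U → ℝ} (hd : ∑ u, d u = 0) :
    ∑ u, d u * (J u / ρ + (r * (pstar u / q u) ^ (r - 1) - 1) / (r - 1)) = 0 := by
  let G : ℝ → ℝ := fun t => (1 / ρ) * ∑ u, (pstar u + t * d u) * J u +
    ∑ u, q u * ((((pstar u + t * d u) / q u) ^ r - (pstar u + t * d u) / q u) / (r - 1))
  have hderiv : HasDerivAt G ((1 / ρ) * ∑ u, d u * J u +
      ∑ u, d u * ((r * (pstar u / q u) ^ (r - 1) - 1) / (r - 1))) 0 := by
    refine (HasDerivAt.const_mul _ (HasDerivAt.fun_sum fun u _ => ?_)).add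
      (HasDerivAt.fun_sum fun u _ => hasDerivAt_mul_rpow_sub_self_div (d u) (hpos u) (hq u))
    simpa using (((hasDerivAt_id (0 : ℝ)).mul_const (d u)).const_add (pstar u)).mul_const (J u)
  have hlocal : IsLocalMin G 0 := by
    have hnonneg : ∀ᶠ t in nhds (0 : ℝ), ∀ u, 0 < pstar u + t * d u := by
      refine Filter.eventually_all.mpr fun u => ?_
      have hcont : Continuous fun t : ℝ => pstar u + t * d u := by fun_prop
      exact hcont.continuousAt.eventually_const_lt (by simpa using hpos u)
    filter_upwards [hnonneg] with t ht
    have hpmf : IsPmf fun u => pstar u + t * d u :=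
      ⟨fun u => (ht u).le, by rw [Finset.sum_add_distrib, ← Finset.mul_sum, hsum, hd]; simp⟩
    have := hmin _ hpmf
    rw [tsallisDiv_eq_sum hr (fun u => (hpos u).le) hq, tsallisDiv_eq_sum hr hpmf.1 hq] at this
    simpa [G] using this
  rw [← hlocal.hasDerivAt_eq_zero hderiv, Finset.mul_sum, ← Finset.sum_add_distrib]
  exact Finset.sum_congr rfl fun u _ => by ring

/-- A strictly positive pmf at which the gradient of the regularized objective is constant
minimizes the objective over all pmfs. -/
theorem isMin_of_gradient_eq_const {U : Type*} [Fintype U] {q J pstar : U → ℝ} {ρ r lam : ℝ}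
    (hq : ∀ u, 0 < q u) (hr0 : 0 < r) (hr1 : r ≠ 1) (hsum : ∑ u, pstar u = 1)
    (hpos : ∀ u, 0 < pstar u)
    (hlam : ∀ u, J u / ρ + (r * (pstar u / q u) ^ (r - 1) - 1) / (r - 1) = lam)
    {p : U → ℝ} (hp : IsPmf p) :
    (1 / ρ) * ∑ u, pstar u * J u + tsallisDiv r pstar q ≤
      (1 / ρ) * ∑ u, p u * J u + tsallisDiv r p q := by
  have hmass : ∑ u, (p u - pstar u) * lam = 0 := by
    rw [← Finset.sum_mul, Finset.sum_sub_distrib, hp.2, hsum, sub_self, zero_mul]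
  rw [tsallisDiv_eq_sum hr0 (fun u => (hpos u).le) hq, tsallisDiv_eq_sum hr0 hp.1 hq,
    Finset.mul_sum, Finset.mul_sum, ← Finset.sum_add_distrib, ← Finset.sum_add_distrib,
    ← add_zero (∑ u, _), ← hmass, ← Finset.sum_add_distrib]
  refine Finset.sum_le_sum fun u _ => ?_
  have htan := mul_le_mul_of_nonneg_left
    (tangent_le_rpow_sub_self_div hr0 hr1 (div_pos (hpos u) (hq u)) (div_nonneg (hp.1 u) (hq u).le))
    (hq u).le
  have hscale : q u * (p u / q u - pstar u / q u) = p u - pstar u := by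
    have := (hq u).ne'
    field_simp
  rw [← hlam u]
  linear_combination htan -
    ((r * (pstar u / q u) ^ (r - 1) - 1) / (r - 1)) * hscale

/-- closed form of the optimal Tsallis-regularized decision density:
a strictly positive pmf `p*` is a minimizer of
`F p = (1/ρ) ∑_u p u · J u + D_r(p‖q)` over pmfs if and only if there is a Lagrange
multiplier `λ` such that `1 + (r-1)(λ - J u / ρ) > 0` and
`p* u = q u · ((1 + (r-1)(λ - J u / ρ))/r)^(1/(r-1))`
`     = r^(-1/(r-1)) · q u · exp_r (λ - J u / ρ)` for every `u`. -/
theorem tsallis_regularized_min_closed_form {U : Type*} [Fintype U] [Nonempty U]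
    (q : U → ℝ) (hq : IsPmf q) (hq' : ∀ u, 0 < q u)
    (J : U → ℝ) (ρ : ℝ) (hρ : 0 < ρ) (r : ℝ) (hr0 : 0 < r) (hr1 : r ≠ 1)
    (pstar : U → ℝ) (hpstar : IsPmf pstar) (hpstar' : ∀ u, 0 < pstar u) :
    (∀ p : U → ℝ, IsPmf p →
        (1 / ρ) * ∑ u, pstar u * J u + tsallisDiv r pstar q ≤
          (1 / ρ) * ∑ u, p u * J u + tsallisDiv r p q) ↔
      ∃ lam : ℝ, ∀ u,
        0 < 1 + (r - 1) * (lam - J u / ρ) ∧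
        pstar u = q u * ((1 + (r - 1) * (lam - J u / ρ)) / r) ^ (1 / (r - 1)) ∧
        pstar u = r ^ (-(1 / (r - 1))) * q u * qexp r (lam - J u / ρ) := by
  have hiff := fun (lam : ℝ) (u : U) =>
    stationarity_iff_closed_form (c := J u / ρ) (lam := lam) hr0 hr1 (hpstar' u) (hq' u)
  simp only [← hiff]
  constructor
  · intro hmin
    classical
    obtain ⟨v⟩ := ‹Nonempty U›
    refine ⟨J v / ρ + (r * (pstar v / q v) ^ (r - 1) - 1) / (r - 1), fun u => sub_eq_zero.mp ?_⟩
    have hzero := sum_mul_gradient_eq_zero_of_isMin hq' hr0 hpstar.2 hpstar' hmin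
      (d := Pi.single u 1 - Pi.single v 1) (by simp)
    simpa [sub_mul, Finset.sum_sub_distrib, Pi.single_apply] using hzero
  · rintro ⟨lam, hlam⟩ p hp
    exact isMin_of_gradient_eq_const hq' hr0 hr1 hpstar.2 hpstar' hlam hp
end
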